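/- For Re(s) > 0 and t > 0, m a nonzero integer: 2π√(|m|t) ∫_0^π cos(2πmt cosθ) I_{s-1/2}(2π|m|t sinθ) (sinθ)^{-1/2} dθ = π |m|^{1/2} t^{1/2} · (2^s Γ(s/2)²/Γ(s)) · J_{s-1/2}(2π|m|t). -/

import Mathlib

open Complex Real

/-- The modified Bessel function of the first kind,
`I_ν(t) = Σ_{j≥0} (t/2)^{ν+2j} / (j! Γ(ν+j+1))` (for `t > 0`). -/
noncomputable def besselI (ν : ℂ) (t : ℝ) : ℂ :=
  ∑' j : ℕ, ((t / 2 : ℝ) : ℂ) ^ (ν + 2 * (j : ℂ)) /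
    ((j.factorial : ℂ) * Complex.Gamma (ν + (j : ℂ) + 1))

/-- The Bessel function of the first kind,
`J_ν(t) = Σ_{j≥0} (-1)^j (t/2)^{ν+2j} / (j! Γ(ν+j+1))` (for `t > 0`). -/
noncomputable def besselJ (ν : ℂ) (t : ℝ) : ℂ :=
  ∑' j : ℕ, (-1 : ℂ) ^ j * ((t / 2 : ℝ) : ℂ) ^ (ν + 2 * (j : ℂ)) /
    ((j.factorial : ℂ) * Complex.Gamma (ν + (j : ℂ) + 1))

open MeasureTheory Set in
lemma sph_image : (fun θ : ℝ => (1 - Real.cos θ) / 2) '' Ioo 0 Real.pi = Ioo 0 1 := by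
  ext x
  constructor
  · rintro ⟨θ, ⟨h0, h1⟩, rfl⟩
    have hs := Real.sin_pos_of_pos_of_lt_pi h0 h1
    have := Real.sin_sq_add_cos_sq θ
    constructor <;> simp only <;> nlinarith
  · rintro ⟨h0, h1⟩
    refine ⟨Real.arccos (1 - 2 * x), ⟨Real.arccos_pos.2 (by linarith), ?_⟩, ?_⟩
    · refine lt_of_le_of_ne (Real.arccos_le_pi _) ?_
      intro h
      rw [Real.arccos_eq_pi] at h
      linarith
    · simp only
      rw [Real.cos_arccos (by linarith) (by linarith)]
      ring

open MeasureTheory Set in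
lemma sph_inj : InjOn (fun θ : ℝ => (1 - Real.cos θ) / 2) (Ioo 0 Real.pi) := by
  intro x hx y hy h
  apply Real.injOn_cos ⟨hx.1.le, hx.2.le⟩ ⟨hy.1.le, hy.2.le⟩
  simp only at h
  linarith

open MeasureTheory Set in
lemma sph_deriv (θ : ℝ) : HasDerivAt (fun θ : ℝ => (1 - Real.cos θ) / 2) (Real.sin θ / 2) θ := by
  have := ((Real.hasDerivAt_cos θ).const_sub 1).div_const 2
  simpa using this

open MeasureTheory Set in
lemma sph_pt (u : ℂ) (θ : ℝ) (hθ : θ ∈ Ioo 0 Real.pi) :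
    |Real.sin θ / 2| • ((((1 - Real.cos θ) / 2 : ℝ) : ℂ) ^ (u - 1) *
      (1 - (((1 - Real.cos θ) / 2 : ℝ) : ℂ)) ^ (u - 1)) =
    (2 : ℂ) ^ (1 - 2 * u) * ((Real.sin θ : ℝ) : ℂ) ^ (2 * u - 1) := by
  have hs := Real.sin_pos_of_pos_of_lt_pi hθ.1 hθ.2
  have h1 := Real.sin_sq_add_cos_sq θ
  have e1 : (1 - (((1 - Real.cos θ) / 2 : ℝ) : ℂ)) = (((1 + Real.cos θ) / 2 : ℝ) : ℂ) := by
    push_cast; ring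
  have hh : (0 : ℝ) < Real.sin θ / 2 := by positivity
  have hhc : ((Real.sin θ / 2 : ℝ) : ℂ) ≠ 0 := by exact_mod_cast hh.ne'
  rw [e1, ← Complex.mul_cpow_ofReal_nonneg (by nlinarith) (by nlinarith), abs_of_pos hh,
    ← Complex.ofReal_mul]
  have e2 : (1 - Real.cos θ) / 2 * ((1 + Real.cos θ) / 2) = Real.sin θ / 2 * (Real.sin θ / 2) := by
    nlinarith
  rw [e2, Complex.ofReal_mul, Complex.mul_cpow_ofReal_nonneg hh.le hh.le, Complex.real_smul,
    ← Complex.cpow_add _ _ hhc]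
  have e3 : ((Real.sin θ / 2 : ℝ) : ℂ) * ((Real.sin θ / 2 : ℝ) : ℂ) ^ (u - 1 + (u - 1)) =
      ((Real.sin θ / 2 : ℝ) : ℂ) ^ (2 * u - 1) := by
    have : 2 * u - 1 = 1 + (u - 1 + (u - 1)) := by ring
    rw [this, Complex.cpow_add 1 _ hhc, Complex.cpow_one]
  rw [e3, div_eq_mul_inv, mul_comm (Real.sin θ), Complex.ofReal_mul,
    Complex.mul_cpow_ofReal_nonneg (by norm_num) hs.le]
  congr 1
  have : (1 - 2 * u) = -(2 * u - 1) := by ring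
  rw [this, Complex.cpow_neg, Complex.ofReal_inv, Complex.inv_cpow]
  · simp
  · rw [show ((2 : ℝ) : ℂ) = ((2 : ℝ) : ℂ) from rfl, Complex.arg_ofReal_of_nonneg (by norm_num)]
    exact Real.pi_pos.ne

open MeasureTheory Set in
lemma sph_sin_integrable (u : ℂ) (hu : 0 < u.re) :
    IntegrableOn (fun θ : ℝ => ((Real.sin θ : ℝ) : ℂ) ^ (2 * u - 1)) (Ioo 0 Real.pi) := by
  have h := Complex.betaIntegral_convergent hu hu
  rw [intervalIntegrable_iff_integrableOn_Ioo_of_le zero_le_one, ← sph_image,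
    integrableOn_image_iff_integrableOn_abs_deriv_smul measurableSet_Ioo
      (fun x _ => (sph_deriv x).hasDerivWithinAt) sph_inj] at h
  have h2 := (integrableOn_congr_fun (sph_pt u) measurableSet_Ioo).1 h
  have h3 := h2.const_mul (((2 : ℂ) ^ (1 - 2 * u))⁻¹)
  refine (integrableOn_congr_fun ?_ measurableSet_Ioo).1 h3
  intro θ _
  simp only
  rw [inv_mul_cancel_left₀]
  simp [Complex.cpow_eq_zero_iff]

open MeasureTheory Set in
lemma sph_sin_integral (u : ℂ) (hu : 0 < u.re) :
    ∫ θ in Ioo 0 Real.pi, ((Real.sin θ : ℝ) : ℂ) ^ (2 * u - 1) =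
      (Real.sqrt Real.pi : ℂ) * Complex.Gamma u / Complex.Gamma (u + 1 / 2) := by
  have h := Complex.Gamma_mul_Gamma_eq_betaIntegral hu hu
  rw [Complex.betaIntegral, intervalIntegral.integral_of_le zero_le_one,
    integral_Ioc_eq_integral_Ioo, ← sph_image,
    integral_image_eq_integral_abs_deriv_smul measurableSet_Ioo
      (fun x _ => (sph_deriv x).hasDerivWithinAt) sph_inj,
    setIntegral_congr_fun measurableSet_Ioo (sph_pt u), integral_const_mul] at h
  have hd := Complex.Gamma_mul_Gamma_add_half u
  have g1 : Complex.Gamma u ≠ 0 := Complex.Gamma_ne_zero_of_re_pos hu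
  have g2 : Complex.Gamma (u + 1 / 2) ≠ 0 := Complex.Gamma_ne_zero_of_re_pos (by simp; linarith)
  have g3 : Complex.Gamma (u + u) ≠ 0 := Complex.Gamma_ne_zero_of_re_pos (by simp; linarith)
  have p : (2 : ℂ) ^ (1 - 2 * u) ≠ 0 := by simp [Complex.cpow_eq_zero_iff]
  rw [eq_div_iff g2]
  rw [two_mul u] at hd p h
  rw [two_mul u]
  apply mul_left_cancel₀ (mul_ne_zero g3 p)
  linear_combination (-Complex.Gamma (u + 1 / 2)) * h + Complex.Gamma u * hd

lemma sph_gamma_step (u c : ℂ) (hu : 0 < u.re) (hc : 0 < c.re) :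
    Complex.Gamma u / Complex.Gamma c - Complex.Gamma (u + 1) / Complex.Gamma (c + 1) =
      (c - u) * Complex.Gamma u / Complex.Gamma (c + 1) := by
  have hu0 : u ≠ 0 := fun h => by simp [h] at hu
  have hc0 : c ≠ 0 := fun h => by simp [h] at hc
  have g2 : Complex.Gamma c ≠ 0 := Complex.Gamma_ne_zero_of_re_pos hc
  rw [Complex.Gamma_add_one u hu0, Complex.Gamma_add_one c hc0]
  field_simp

open MeasureTheory Set in
lemma sph_cos_sin_integrable (k : ℕ) (u : ℂ) (hu : 0 < u.re) :
    IntegrableOn (fun θ : ℝ => ((Real.cos θ : ℝ) : ℂ) ^ (2 * k) *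
      ((Real.sin θ : ℝ) : ℂ) ^ (2 * u - 1)) (Ioo 0 Real.pi) := by
  refine (sph_sin_integrable u hu).bdd_mul (c := 1) ?_ ?_
  · exact Continuous.aestronglyMeasurable (by fun_prop)
  · refine Filter.Eventually.of_forall fun θ => ?_
    rw [norm_pow, Complex.norm_real, Real.norm_eq_abs]
    exact pow_le_one₀ (abs_nonneg _) (Real.abs_cos_le_one θ)

open MeasureTheory Set in
lemma sph_cos_sin_integral (k : ℕ) : ∀ (u : ℂ), 0 < u.re →
    ∫ θ in Ioo 0 Real.pi, ((Real.cos θ : ℝ) : ℂ) ^ (2 * k) *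
      ((Real.sin θ : ℝ) : ℂ) ^ (2 * u - 1) =
      Complex.Gamma (k + 1 / 2) * Complex.Gamma u / Complex.Gamma (u + k + 1 / 2) := by
  induction k with
  | zero =>
    intro u hu
    have : ((Real.sqrt Real.pi : ℝ) : ℂ) = Complex.Gamma (1 / 2) := by
      have := Real.Gamma_one_half_eq
      rw [← this, ← Complex.Gamma_ofReal]; norm_num
    simpa [this] using sph_sin_integral u hu
  | succ k ih =>
    intro u hu
    have hu1 : 0 < (u + 1).re := by simp; linarith
    have e : ∀ θ ∈ Ioo 0 Real.pi, ((Real.cos θ : ℝ) : ℂ) ^ (2 * (k + 1)) *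
        ((Real.sin θ : ℝ) : ℂ) ^ (2 * u - 1) =
        ((Real.cos θ : ℝ) : ℂ) ^ (2 * k) * ((Real.sin θ : ℝ) : ℂ) ^ (2 * u - 1) -
        ((Real.cos θ : ℝ) : ℂ) ^ (2 * k) * ((Real.sin θ : ℝ) : ℂ) ^ (2 * (u + 1) - 1) := by
      intro θ hθ
      have hs := Real.sin_pos_of_pos_of_lt_pi hθ.1 hθ.2
      have hsc : ((Real.sin θ : ℝ) : ℂ) ≠ 0 := by exact_mod_cast hs.ne'
      have h1 : ((Real.sin θ : ℝ) : ℂ) ^ 2 + ((Real.cos θ : ℝ) : ℂ) ^ 2 = 1 := by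
        exact_mod_cast Real.sin_sq_add_cos_sq θ
      have : 2 * (u + 1) - 1 = (2 * u - 1) + (2 : ℕ) := by push_cast; ring
      rw [this, Complex.cpow_add _ _ hsc, Complex.cpow_natCast, mul_add, pow_add, mul_one]
      linear_combination ((Real.cos θ : ℝ) : ℂ) ^ (2 * k) *
        ((Real.sin θ : ℝ) : ℂ) ^ (2 * u - 1) * h1
    rw [setIntegral_congr_fun measurableSet_Ioo e,
      integral_sub (sph_cos_sin_integrable k u hu) (sph_cos_sin_integrable k _ hu1),
      ih u hu, ih (u + 1) hu1]
    have hg := sph_gamma_step u (u + k + 1 / 2) hu (by simp; positivity)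
    have hk : (k : ℂ) + 1 / 2 ≠ 0 := by
      intro h
      have := congrArg Complex.re h
      simp at this
      have : (0:ℝ) ≤ k := by positivity
      linarith
    have hk2 := Complex.Gamma_add_one _ hk
    push_cast
    rw [show (k : ℂ) + 1 + 1 / 2 = k + 1 / 2 + 1 by ring, hk2,
      show u + 1 + k + 1 / 2 = u + k + 1 / 2 + 1 by ring,
      show u + (k + 1) + 1 / 2 = u + k + 1 / 2 + 1 by ring]
    linear_combination Complex.Gamma (k + 1 / 2) * hg

/-- Chu–Vandermonde in Gamma form. -/
lemma sph_chu (n : ℕ) : ∀ u c : ℂ, 0 < u.re → u.re < c.re →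
    ∑ p ∈ Finset.HasAntidiagonal.antidiagonal n, (n.choose p.1 : ℂ) * ((-1) ^ p.1 *
      (Complex.Gamma (u + p.1) / Complex.Gamma (c + p.1))) =
    Complex.Gamma u * Complex.Gamma (c - u + n) /
      (Complex.Gamma (c - u) * Complex.Gamma (c + n)) := by
  induction n with
  | zero =>
    intro u c hu hc
    have : Complex.Gamma (c - u) ≠ 0 := Complex.Gamma_ne_zero_of_re_pos (by simp; linarith)
    simp
    field_simp
  | succ n ih =>
    intro u c hu hc
    have := Finset.sum_antidiagonal_choose_succ_mul (R := ℂ)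
      (fun i _ => (-1) ^ i * (Complex.Gamma (u + i) / Complex.Gamma (c + i))) n
    rw [this]
    have h1 := ih u c hu hc
    have h2 := ih (u + 1) (c + 1) (by simp; linarith) (by simp; linarith)
    rw [h1]
    have e : ∑ x ∈ Finset.HasAntidiagonal.antidiagonal n, (n.choose x.2 : ℂ) * ((-1) ^ (x.1 + 1) *
        (Complex.Gamma (u + ((x.1 + 1 : ℕ) : ℂ)) / Complex.Gamma (c + ((x.1 + 1 : ℕ) : ℂ)))) =
        - ∑ x ∈ Finset.HasAntidiagonal.antidiagonal n, (n.choose x.1 : ℂ) * ((-1) ^ x.1 *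
        (Complex.Gamma (u + 1 + x.1) / Complex.Gamma (c + 1 + x.1))) := by
      rw [← Finset.sum_neg_distrib]
      refine Finset.sum_congr rfl fun x hx => ?_
      rw [Nat.choose_symm_of_eq_add (Finset.HasAntidiagonal.mem_antidiagonal.1 hx).symm]
      push_cast
      rw [show u + (x.1 + 1 : ℂ) = u + 1 + x.1 by ring, show c + (x.1 + 1 : ℂ) = c + 1 + x.1 by ring]
      ring
    rw [e, h2]
    have hu0 : u ≠ 0 := fun h => by simp [h] at hu
    have hcn : 0 < (c + n).re := by
      have : (0:ℝ) ≤ n := by positivity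
      simp; linarith
    have hcn' : 0 < (c - u + n).re := by
      have : (0:ℝ) ≤ n := by positivity
      simp; linarith
    have hcn0 : c + n ≠ 0 := fun h => by simp [h] at hcn
    have hcn0' : c - u + n ≠ 0 := fun h => by simp [h] at hcn'
    have g1 : Complex.Gamma (c - u) ≠ 0 := Complex.Gamma_ne_zero_of_re_pos (by simp; linarith)
    have g2 : Complex.Gamma (c + n) ≠ 0 := Complex.Gamma_ne_zero_of_re_pos hcn
    push_cast
    rw [show c + 1 - (u + 1) = c - u by ring, show c + 1 + n = c + n + 1 by ring,
      show c + (n + 1 : ℂ) = c + n + 1 by ring, show c - u + (n + 1 : ℂ) = c - u + n + 1 by ring,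
      Complex.Gamma_add_one _ hu0, Complex.Gamma_add_one _ hcn0, Complex.Gamma_add_one _ hcn0']
    field_simp
    ring

lemma sph_gamma_half (k : ℕ) :
    Complex.Gamma (k + 1 / 2) * 4 ^ k * (k.factorial : ℂ) =
      (Real.sqrt Real.pi : ℂ) * ((2 * k).factorial : ℂ) := by
  induction k with
  | zero =>
    have : ((Real.sqrt Real.pi : ℝ) : ℂ) = Complex.Gamma (1 / 2) := by
      have := Real.Gamma_one_half_eq
      rw [← this, ← Complex.Gamma_ofReal]; norm_num
    simp [this]
  | succ k ih =>
    have hk : (k : ℂ) + 1 / 2 ≠ 0 := by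
      intro h
      have := congrArg Complex.re h
      simp at this
      have : (0:ℝ) ≤ k := by positivity
      linarith
    rw [show 2 * (k + 1) = 2 * k + 1 + 1 by ring, Nat.factorial_succ, Nat.factorial_succ,
      Nat.factorial_succ]
    push_cast
    rw [show (k : ℂ) + 1 + 1 / 2 = k + 1 / 2 + 1 by ring, Complex.Gamma_add_one _ hk]
    linear_combination (k + 1 / 2 : ℂ) * 4 * (k + 1) * ih

noncomputable def sphB (s : ℂ) (a : ℝ) (j : ℕ) : ℂ :=
  ((a / 2 : ℝ) : ℂ) ^ (s - 1 / 2 + 2 * (j : ℂ)) /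
    ((j.factorial : ℂ) * Complex.Gamma (s - 1 / 2 + (j : ℂ) + 1))

noncomputable def sphD (a : ℝ) (k : ℕ) : ℂ :=
  (-1 : ℂ) ^ k * (a : ℂ) ^ (2 * k) / ((2 * k).factorial : ℂ)

lemma sph_b_step (s : ℂ) (hs : 0 < s.re) (a : ℝ) (ha : 0 < a) (j : ℕ) :
    ‖sphB s a (j + 1)‖ ≤ (2 * (a / 2) ^ 2) / (j + 1) * ‖sphB s a j‖ := by
  have hz : ((a / 2 : ℝ) : ℂ) ≠ 0 := by
    exact_mod_cast (by positivity : a / 2 ≠ 0)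
  have hre : 0 < (s - 1 / 2 + j + 1).re := by
    have : (0:ℝ) ≤ j := by positivity
    simp; linarith
  have hn : 1 / 2 ≤ ‖s - 1 / 2 + j + 1‖ := by
    refine le_trans ?_ (Complex.re_le_norm _)
    have : (0:ℝ) ≤ j := by positivity
    simp; linarith
  have h0 : s - 1 / 2 + j + 1 ≠ 0 := fun h => by rw [h] at hre; simp at hre
  have g : Complex.Gamma (s - 1 / 2 + j + 1) ≠ 0 := Complex.Gamma_ne_zero_of_re_pos hre
  have e : sphB s a (j + 1) =
      (((a / 2) ^ 2 : ℝ) : ℂ) / ((j + 1 : ℕ) * (s - 1 / 2 + j + 1)) * sphB s a j := by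
    unfold sphB
    rw [Nat.factorial_succ]
    push_cast
    rw [show s - 1 / 2 + ((j : ℂ) + 1) + 1 = s - 1 / 2 + j + 1 + 1 by ring,
      Complex.Gamma_add_one _ h0,
      show s - 1 / 2 + 2 * ((j : ℂ) + 1) = s - 1 / 2 + 2 * j + (2 : ℕ) by push_cast; ring]
    push_cast at hz
    rw [Complex.cpow_add _ _ hz, Complex.cpow_natCast]
    have : (j : ℂ) + 1 ≠ 0 := by exact_mod_cast Nat.succ_ne_zero j
    have : (j.factorial : ℂ) ≠ 0 := by exact_mod_cast Nat.factorial_ne_zero j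
    generalize Complex.Gamma (s - 1 / 2 + j + 1) = G at *
    generalize (s - 1 / 2 + j + 1) = w at *
    field_simp
  rw [e, norm_mul]
  refine mul_le_mul_of_nonneg_right ?_ (norm_nonneg _)
  rw [norm_div, norm_mul, Complex.norm_real, Complex.norm_natCast, Real.norm_of_nonneg (by positivity)]
  push_cast
  have hj : (0:ℝ) < j + 1 := by positivity
  rw [div_le_div_iff₀ (by positivity) hj]
  have : 0 ≤ (a / 2) ^ 2 * ((j : ℝ) + 1) := by positivity
  nlinarith

lemma sph_b_summable (s : ℂ) (hs : 0 < s.re) (a : ℝ) (ha : 0 < a) :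
    Summable fun j => ‖sphB s a j‖ := by
  have h : ∀ j, ‖sphB s a j‖ ≤ ‖sphB s a 0‖ * ((2 * (a / 2) ^ 2) ^ j / (j.factorial : ℝ)) := by
    intro j
    induction j with
    | zero => simp
    | succ j ih =>
      refine (sph_b_step s hs a ha j).trans ?_
      refine (mul_le_mul_of_nonneg_left ih (by positivity)).trans (le_of_eq ?_)
      rw [Nat.factorial_succ, pow_succ]
      push_cast
      have : (j.factorial : ℝ) ≠ 0 := by exact_mod_cast Nat.factorial_ne_zero j
      field_simp
      ring
  exact Summable.of_nonneg_of_le (fun _ => norm_nonneg _) h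
    ((Real.summable_pow_div_factorial _).mul_left _)

lemma sph_d_summable (a : ℝ) : Summable fun k => ‖sphD a k‖ :=
  (Complex.hasSum_cos (a : ℂ)).summable.norm

open MeasureTheory Set in
lemma sph_term (s : ℂ) (hs : 0 < s.re) (a : ℝ) (j k : ℕ) :
    ∫ θ in Ioo 0 Real.pi, (sphB s a j * ((Real.sin θ : ℝ) : ℂ) ^ (s - 1 + 2 * (j : ℂ))) *
      (sphD a k * ((Real.cos θ : ℝ) : ℂ) ^ (2 * k)) =
    sphB s a j * sphD a k * (Complex.Gamma (k + 1 / 2) * Complex.Gamma (s / 2 + j) /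
      Complex.Gamma (s / 2 + j + k + 1 / 2)) := by
  rw [← sph_cos_sin_integral k (s / 2 + j) (by
    have : (0:ℝ) ≤ j := by positivity
    simp; linarith), ← integral_const_mul]
  congr 1
  ext θ
  rw [show 2 * (s / 2 + j) - 1 = s - 1 + 2 * (j : ℂ) by ring]
  ring

open MeasureTheory Set in
lemma sph_term_integrable (s : ℂ) (hs : 0 < s.re) (a : ℝ) (j k : ℕ) :
    IntegrableOn (fun θ : ℝ => (sphB s a j * ((Real.sin θ : ℝ) : ℂ) ^ (s - 1 + 2 * (j : ℂ))) *
      (sphD a k * ((Real.cos θ : ℝ) : ℂ) ^ (2 * k))) (Ioo 0 Real.pi) := by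
  have := (sph_cos_sin_integrable k (s / 2 + j) (by
    have : (0:ℝ) ≤ j := by positivity
    simp; linarith)).const_mul (sphB s a j * sphD a k)
  refine this.congr (Filter.Eventually.of_forall fun θ => ?_)
  simp only
  rw [show 2 * (s / 2 + j) - 1 = s - 1 + 2 * (j : ℂ) by ring]
  ring

lemma sph_coeff (s : ℂ) (hs : 0 < s.re) (a : ℝ) (ha : 0 < a) (n : ℕ) :
    ∑ p ∈ Finset.HasAntidiagonal.antidiagonal n, sphB s a p.1 * sphD a p.2 *
      (Complex.Gamma (p.2 + 1 / 2) * Complex.Gamma (s / 2 + p.1) /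
      Complex.Gamma (s / 2 + p.1 + p.2 + 1 / 2)) =
    (Real.sqrt Real.pi : ℂ) * Complex.Gamma (s / 2) / Complex.Gamma (s / 2 + 1 / 2) *
      ((-1 : ℂ) ^ n * ((a / 2 : ℝ) : ℂ) ^ (s - 1 / 2 + 2 * (n : ℂ)) /
    ((n.factorial : ℂ) * Complex.Gamma (s - 1 / 2 + (n : ℂ) + 1))) := by
  have hz : ((a / 2 : ℝ) : ℂ) ≠ 0 := by
    exact_mod_cast (by positivity : a / 2 ≠ 0)
  have hnn : (0:ℝ) ≤ n := by positivity
  have g1 : Complex.Gamma (s / 2 + n + 1 / 2) ≠ 0 := Complex.Gamma_ne_zero_of_re_pos (by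
    simp; linarith)
  have g2 : Complex.Gamma (s / 2 + 1 / 2) ≠ 0 := Complex.Gamma_ne_zero_of_re_pos (by
    simp; linarith)
  have g3 : Complex.Gamma (s - 1 / 2 + n + 1) ≠ 0 := Complex.Gamma_ne_zero_of_re_pos (by
    simp; linarith)
  have fn : (n.factorial : ℂ) ≠ 0 := by exact_mod_cast Nat.factorial_ne_zero n
  have hchu := sph_chu n (s / 2) (s + 1 / 2) (by simp; linarith) (by simp; linarith)
  have key : ∀ p ∈ Finset.HasAntidiagonal.antidiagonal n, sphB s a p.1 * sphD a p.2 *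
      (Complex.Gamma (p.2 + 1 / 2) * Complex.Gamma (s / 2 + p.1) /
      Complex.Gamma (s / 2 + p.1 + p.2 + 1 / 2)) =
      ((Real.sqrt Real.pi : ℂ) * ((-1 : ℂ) ^ n * ((a / 2 : ℝ) : ℂ) ^ (s - 1 / 2 + 2 * (n : ℂ))) /
        ((n.factorial : ℂ) * Complex.Gamma (s / 2 + n + 1 / 2))) *
      ((n.choose p.1 : ℂ) * ((-1) ^ p.1 *
      (Complex.Gamma (s / 2 + p.1) / Complex.Gamma (s + 1 / 2 + p.1)))) := by
    rintro ⟨j, k⟩ hp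
    have hjk : j + k = n := Finset.HasAntidiagonal.mem_antidiagonal.1 hp
    subst hjk
    simp only
    have hj : (0:ℝ) ≤ j := by positivity
    have g4 : Complex.Gamma (s + 1 / 2 + j) ≠ 0 := Complex.Gamma_ne_zero_of_re_pos (by
      simp; linarith)
    have hh := sph_gamma_half k
    have fj : (j.factorial : ℂ) ≠ 0 := by exact_mod_cast Nat.factorial_ne_zero j
    have fk : (k.factorial : ℂ) ≠ 0 := by exact_mod_cast Nat.factorial_ne_zero k
    have f2k : ((2 * k).factorial : ℂ) ≠ 0 := by exact_mod_cast Nat.factorial_ne_zero (2 * k)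
    have hc : ((j + k).choose j : ℂ) * (j.factorial : ℂ) * (k.factorial : ℂ) =
        ((j + k).factorial : ℂ) := by
      rw [Nat.choose_symm_add]
      exact_mod_cast Nat.add_choose_mul_factorial_mul_factorial j k
    have hG : Complex.Gamma (k + 1 / 2) =
        (Real.sqrt Real.pi : ℂ) * ((2 * k).factorial : ℂ) / (4 ^ k * (k.factorial : ℂ)) := by
      rw [eq_div_iff (mul_ne_zero (by simp) fk), ← hh]; ring
    have hpow : (a : ℂ) ^ (2 * k) = 4 ^ k * ((a / 2 : ℝ) : ℂ) ^ (2 * k) := by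
      rw [pow_mul, pow_mul, ← mul_pow]; congr 1; push_cast; ring
    have hcp : ((a / 2 : ℝ) : ℂ) ^ (s - 1 / 2 + 2 * ((j + k : ℕ) : ℂ)) =
        ((a / 2 : ℝ) : ℂ) ^ (s - 1 / 2 + 2 * (j : ℂ)) * ((a / 2 : ℝ) : ℂ) ^ (2 * k) := by
      rw [← Complex.cpow_natCast _ (2 * k), ← Complex.cpow_add _ _ hz]
      congr 1; push_cast; ring
    have hsg : (-1 : ℂ) ^ (j + k) * (-1) ^ j = (-1) ^ k := by
      rw [pow_add, mul_right_comm, ← mul_pow]; simp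
    unfold sphB sphD
    rw [hG, hpow, hcp, ← hc, ← hsg]
    have e1 : s / 2 + j + k + 1 / 2 = s / 2 + ((j + k : ℕ) : ℂ) + 1 / 2 := by push_cast; ring
    rw [e1, show s - 1 / 2 + (j : ℂ) + 1 = s + 1 / 2 + j by ring]
    have hch : ((j + k).choose j : ℂ) ≠ 0 := by
      exact_mod_cast (Nat.choose_pos (Nat.le_add_right j k)).ne'
    generalize Complex.Gamma (s / 2 + ((j + k : ℕ) : ℂ) + 1 / 2) = G1 at *
    generalize Complex.Gamma (s + 1 / 2 + j) = G2 at *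
    generalize Complex.Gamma (s / 2 + j) = G3 at *
    generalize ((a / 2 : ℝ) : ℂ) ^ (s - 1 / 2 + 2 * (j : ℂ)) = Z at *
    generalize ((a / 2 : ℝ) : ℂ) ^ (2 * k) = Y at *
    generalize ((j + k).choose j : ℂ) = C at *
    field_simp
  rw [Finset.sum_congr rfl key, ← Finset.mul_sum, hchu,
    show s + 1 / 2 - s / 2 + (n : ℂ) = s / 2 + n + 1 / 2 by ring,
    show s + 1 / 2 - s / 2 = s / 2 + 1 / 2 by ring,
    show s + 1 / 2 + (n : ℂ) = s - 1 / 2 + n + 1 by ring]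
  generalize Complex.Gamma (s / 2 + n + 1 / 2) = G1 at *
  generalize Complex.Gamma (s - 1 / 2 + n + 1) = G2 at *
  generalize Complex.Gamma (s / 2 + 1 / 2) = G3 at *
  field_simp

open MeasureTheory Set in
lemma sph_pointwise (s : ℂ) (hs : 0 < s.re) (a : ℝ) (ha : 0 < a) (θ : ℝ)
    (hθ : θ ∈ Ioo 0 Real.pi) :
    HasSum (fun n => ∑ p ∈ Finset.HasAntidiagonal.antidiagonal n,
      (sphB s a p.1 * ((Real.sin θ : ℝ) : ℂ) ^ (s - 1 + 2 * (p.1 : ℂ))) *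
      (sphD a p.2 * ((Real.cos θ : ℝ) : ℂ) ^ (2 * p.2)))
      (Complex.cos ((a : ℂ) * ((Real.cos θ : ℝ) : ℂ)) *
          besselI (s - 1 / 2) (a * Real.sin θ) *
          ((Real.sin θ ^ (-(1 / 2) : ℝ) : ℝ) : ℂ)) := by
  have hsin := Real.sin_pos_of_pos_of_lt_pi hθ.1 hθ.2
  have hsc : ((Real.sin θ : ℝ) : ℂ) ≠ 0 := by exact_mod_cast hsin.ne'
  have hB : Summable fun j : ℕ =>
      ‖sphB s a j * ((Real.sin θ : ℝ) : ℂ) ^ (s - 1 + 2 * (j : ℂ))‖ := by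
    refine Summable.of_nonneg_of_le (fun _ => norm_nonneg _) (fun j => ?_)
      ((sph_b_summable s hs a ha).mul_right (‖((Real.sin θ : ℝ) : ℂ) ^ (s - 1)‖))
    rw [norm_mul]
    refine mul_le_mul_of_nonneg_left ?_ (norm_nonneg _)
    rw [Complex.norm_cpow_eq_rpow_re_of_pos hsin, Complex.norm_cpow_eq_rpow_re_of_pos hsin]
    refine Real.rpow_le_rpow_of_exponent_ge hsin (Real.sin_le_one θ) ?_
    simp
  have hD : Summable fun k : ℕ => ‖sphD a k * ((Real.cos θ : ℝ) : ℂ) ^ (2 * k)‖ := by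
    refine Summable.of_nonneg_of_le (fun _ => norm_nonneg _) (fun k => ?_) (sph_d_summable a)
    rw [norm_mul, norm_pow, Complex.norm_real, Real.norm_eq_abs]
    exact mul_le_of_le_one_right (norm_nonneg _)
      (pow_le_one₀ (abs_nonneg _) (Real.abs_cos_le_one θ))
  have h1 := (summable_norm_sum_mul_antidiagonal_of_summable_norm hB hD).of_norm.hasSum
  rw [← tsum_mul_tsum_eq_tsum_sum_antidiagonal_of_summable_norm hB hD] at h1
  have hcos : Complex.cos ((a : ℂ) * ((Real.cos θ : ℝ) : ℂ)) =
      ∑' k : ℕ, sphD a k * ((Real.cos θ : ℝ) : ℂ) ^ (2 * k) := by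
    rw [← (Complex.hasSum_cos _).tsum_eq]
    congr 1
    ext k
    unfold sphD
    rw [mul_pow]
    ring
  have hI : besselI (s - 1 / 2) (a * Real.sin θ) * ((Real.sin θ ^ (-(1 / 2) : ℝ) : ℝ) : ℂ) =
      ∑' j : ℕ, sphB s a j * ((Real.sin θ : ℝ) : ℂ) ^ (s - 1 + 2 * (j : ℂ)) := by
    unfold besselI
    rw [← tsum_mul_right]
    congr 1
    ext j
    unfold sphB
    rw [mul_div_right_comm, Complex.ofReal_mul,
      Complex.mul_cpow_ofReal_nonneg (by positivity) hsin.le, Complex.ofReal_cpow hsin.le,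
      show s - 1 + 2 * (j : ℂ) = s - 1 / 2 + 2 * (j : ℂ) + ((-(1 / 2) : ℝ) : ℂ) by push_cast; ring,
      Complex.cpow_add (s - 1 / 2 + 2 * (j : ℂ)) _ hsc]
    ring
  rw [mul_assoc, hI, hcos, mul_comm]
  exact h1

open MeasureTheory Set in
lemma sph_core (s : ℂ) (hs : 0 < s.re) (a : ℝ) (ha : 0 < a) :
    ∫ θ in Ioo 0 Real.pi, (Complex.cos ((a : ℂ) * ((Real.cos θ : ℝ) : ℂ)) *
          besselI (s - 1 / 2) (a * Real.sin θ) *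
          ((Real.sin θ ^ (-(1 / 2) : ℝ) : ℝ) : ℂ)) =
    (Real.sqrt Real.pi : ℂ) * Complex.Gamma (s / 2) / Complex.Gamma (s / 2 + 1 / 2) *
      besselJ (s - 1 / 2) a := by
  have hM : Summable fun n => ∑ p ∈ Finset.HasAntidiagonal.antidiagonal n,
      ‖sphB s a p.1‖ * ‖sphD a p.2‖ := by
    refine summable_sum_mul_antidiagonal_of_summable_mul
      (f := fun j => ‖sphB s a j‖) (g := fun k => ‖sphD a k‖) ?_
    exact (sph_b_summable s hs a ha).mul_of_nonneg (sph_d_summable a)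
      (fun _ => norm_nonneg _) (fun _ => norm_nonneg _)
  have hsi : IntegrableOn (fun θ : ℝ => ‖((Real.sin θ : ℝ) : ℂ) ^ (s - 1)‖) (Ioo 0 Real.pi) := by
    have := (sph_sin_integrable (s / 2) (by simp; linarith)).norm
    rwa [show 2 * (s / 2) - 1 = s - 1 by ring] at this
  have hint : ∀ p : ℕ × ℕ, Integrable (fun θ : ℝ =>
      (sphB s a p.1 * ((Real.sin θ : ℝ) : ℂ) ^ (s - 1 + 2 * (p.1 : ℂ))) *
      (sphD a p.2 * ((Real.cos θ : ℝ) : ℂ) ^ (2 * p.2))) (volume.restrict (Ioo 0 Real.pi)) :=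
    fun p => sph_term_integrable s hs a p.1 p.2
  have H := hasSum_integral_of_dominated_convergence (μ := volume.restrict (Ioo 0 Real.pi))
    (F := fun n θ => ∑ p ∈ Finset.HasAntidiagonal.antidiagonal n,
      (sphB s a p.1 * ((Real.sin θ : ℝ) : ℂ) ^ (s - 1 + 2 * (p.1 : ℂ))) *
      (sphD a p.2 * ((Real.cos θ : ℝ) : ℂ) ^ (2 * p.2)))
    (bound := fun n θ => (∑ p ∈ Finset.HasAntidiagonal.antidiagonal n,
      ‖sphB s a p.1‖ * ‖sphD a p.2‖) * ‖((Real.sin θ : ℝ) : ℂ) ^ (s - 1)‖)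
    (fun n => (integrable_finsetSum _
      fun p _ => hint p).aestronglyMeasurable)
    (fun n => ae_restrict_of_forall_mem measurableSet_Ioo (fun θ hθ => by
      refine (norm_sum_le _ _).trans ?_
      rw [Finset.sum_mul]
      refine Finset.sum_le_sum fun p _ => ?_
      have hsin := Real.sin_pos_of_pos_of_lt_pi hθ.1 hθ.2
      have h1 : ‖((Real.sin θ : ℝ) : ℂ) ^ (s - 1 + 2 * (p.1 : ℂ))‖ ≤
          ‖((Real.sin θ : ℝ) : ℂ) ^ (s - 1)‖ := by
        rw [Complex.norm_cpow_eq_rpow_re_of_pos hsin, Complex.norm_cpow_eq_rpow_re_of_pos hsin]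
        refine Real.rpow_le_rpow_of_exponent_ge hsin (Real.sin_le_one θ) ?_
        simp
      have h2 : ‖((Real.cos θ : ℝ) : ℂ) ^ (2 * p.2)‖ ≤ 1 := by
        rw [norm_pow, Complex.norm_real, Real.norm_eq_abs]
        exact pow_le_one₀ (abs_nonneg _) (Real.abs_cos_le_one θ)
      rw [norm_mul, norm_mul, norm_mul]
      calc _ ≤ ‖sphB s a p.1‖ * ‖((Real.sin θ : ℝ) : ℂ) ^ (s - 1)‖ * (‖sphD a p.2‖ * 1) := by
            gcongr
        _ = _ := by ring))
    (Filter.Eventually.of_forall fun θ => hM.mul_right _)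
    (by
      simp only [tsum_mul_right]
      exact hsi.const_mul _)
    (ae_restrict_of_forall_mem measurableSet_Ioo (sph_pointwise s hs a ha))
  rw [← H.tsum_eq, besselJ, ← tsum_mul_left]
  congr 1
  ext n
  rw [integral_finsetSum _ fun p _ => hint p, ← sph_coeff s hs a ha n]
  exact Finset.sum_congr rfl fun p _ => sph_term s hs a p.1 p.2

/-- The spherical integral identity (Lemma 9 of Duke–Imamoğlu–Tóth):
`2π√(|m|t) ∫_0^π cos(2πmt cosθ) I_{s-1/2}(2π|m|t sinθ) (sinθ)^{-1/2} dθ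
  = π |m|^{1/2} t^{1/2} (2^s Γ(s/2)²/Γ(s)) J_{s-1/2}(2π|m|t)`. -/
theorem spherical_integral_identity (s : ℂ) (hs : 0 < s.re) (t : ℝ) (ht : 0 < t)
    (m : ℤ) (hm : m ≠ 0) :
    2 * (Real.pi : ℂ) * ((Real.sqrt (|(m : ℝ)| * t) : ℝ) : ℂ) *
      ∫ θ in (0 : ℝ)..Real.pi,
        Complex.cos (2 * Real.pi * (m : ℂ) * (t : ℂ) * ((Real.cos θ : ℝ) : ℂ)) *
          besselI (s - 1 / 2) (2 * Real.pi * |(m : ℝ)| * t * Real.sin θ) *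
          ((Real.sin θ ^ (-(1 / 2) : ℝ) : ℝ) : ℂ) =
    (Real.pi : ℂ) * ((Real.sqrt |(m : ℝ)| : ℝ) : ℂ) * ((Real.sqrt t : ℝ) : ℂ) *
      ((2 : ℂ) ^ s * Complex.Gamma (s / 2) ^ 2 / Complex.Gamma s) *
      besselJ (s - 1 / 2) (2 * Real.pi * |(m : ℝ)| * t) := by
  have hm' : 0 < |(m : ℝ)| := abs_pos.2 (by exact_mod_cast hm)
  have ha : 0 < 2 * Real.pi * |(m : ℝ)| * t := by positivity
  have hcore := sph_core s hs _ ha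
  rw [intervalIntegral.integral_of_le Real.pi_pos.le, MeasureTheory.integral_Ioc_eq_integral_Ioo]
  have hcos : ∀ x : ℂ, Complex.cos (2 * Real.pi * (m : ℂ) * (t : ℂ) * x) =
      Complex.cos (((2 * Real.pi * |(m : ℝ)| * t : ℝ) : ℂ) * x) := by
    intro x
    rcases abs_choice (m : ℝ) with h | h
    · rw [h]; push_cast; rfl
    · rw [h, ← Complex.cos_neg]; push_cast; congr 1; ring
  simp only [hcos]
  rw [hcore, Real.sqrt_mul hm'.le, Complex.ofReal_mul]
  have hd := Complex.Gamma_mul_Gamma_add_half (s / 2)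
  rw [show 2 * (s / 2) = s by ring, Complex.cpow_sub _ _ two_ne_zero, Complex.cpow_one] at hd
  have g1 : Complex.Gamma (s / 2 + 1 / 2) ≠ 0 := Complex.Gamma_ne_zero_of_re_pos (by
    simp; linarith)
  have g2 : Complex.Gamma s ≠ 0 := Complex.Gamma_ne_zero_of_re_pos hs
  have p : (2 : ℂ) ^ s ≠ 0 := by simp [Complex.cpow_eq_zero_iff]
  have key : 2 * ((Real.sqrt Real.pi : ℂ) * Complex.Gamma (s / 2) / Complex.Gamma (s / 2 + 1 / 2)) =
      (2 : ℂ) ^ s * Complex.Gamma (s / 2) ^ 2 / Complex.Gamma s := by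
    generalize Complex.Gamma (s / 2 + 1 / 2) = G1 at *
    generalize Complex.Gamma (s / 2) = G2 at *
    rw [mul_div_assoc', div_mul_eq_mul_div, eq_div_iff p] at hd
    rw [mul_div_assoc', div_eq_div_iff g1 g2]
    linear_combination (-G2) * hd
  rw [← key]
  ring
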